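/- For ν > −1, x, y ∈ [1,∞), and t ∈ [0,∞), the improper integral K_t(x,y) = ∫_t^∞ (s√(xy) J_ν(xs)J_ν(ys) − (2/π) cos(xs−α)cos(ys−α)) ds converges, and K_0(x,y) = −sin(2α)/(π(x+y)), where α = πν/2 + π/4. -/

import Mathlib

open Filter

noncomputable section

/-- The Bessel function of the first kind of order `ν`. -/
noncomputable def besselJ (ν : ℝ) (x : ℝ) : ℝ :=
  ∑' k : ℕ, ((-1 : ℝ) ^ k / (Nat.factorial k * Real.Gamma (ν + k + 1))) *
    (x / 2) ^ (2 * (k : ℝ) + ν)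

/-- Coefficients of the entire part of the Bessel function. -/
def bC (ν : ℝ) (k : ℕ) : ℝ := (-1 : ℝ) ^ k / (Nat.factorial k * Real.Gamma (ν + k + 1))

/-- Entire part of the Bessel function. -/
def bG (ν : ℝ) (w : ℝ) : ℝ := ∑' k : ℕ, bC ν k * w ^ k

lemma bC_bound (ν : ℝ) (hν : -1 < ν) : ∃ M : ℝ, 0 < M ∧ ∀ k : ℕ, |bC ν k| ≤ M / Nat.factorial k := by
  have h1 : 0 < Real.Gamma (ν + 1) := Real.Gamma_pos_of_pos (by linarith)
  have h2 : 0 < Real.Gamma (ν + 2) := Real.Gamma_pos_of_pos (by linarith)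
  set m := min (Real.Gamma (ν + 1)) (Real.Gamma (ν + 2)) with hm
  have hm0 : 0 < m := lt_min h1 h2
  have hk1 : ∀ k : ℕ, Real.Gamma (ν + 2) ≤ Real.Gamma (ν + (k + 1 : ℕ) + 1) := by
    intro k
    induction k with
    | zero => simp; rw [show ν + 1 + 1 = ν + 2 by ring]
    | succ k ih =>
      refine ih.trans ?_
      have : ν + ((k + 1 + 1 : ℕ) : ℝ) + 1 = (ν + (k + 1 : ℕ) + 1) + 1 := by push_cast; ring
      have hk : (0:ℝ) ≤ k := Nat.cast_nonneg k
      rw [this, Real.Gamma_add_one (s := ν + (k + 1 : ℕ) + 1) (by push_cast; linarith)]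
      have hp : 0 < Real.Gamma (ν + (k + 1 : ℕ) + 1) := Real.Gamma_pos_of_pos (by push_cast; linarith)
      push_cast at hp ⊢
      nlinarith
  have hk : ∀ k : ℕ, m ≤ Real.Gamma (ν + k + 1) := by
    intro k
    cases k with
    | zero => simp [hm]
    | succ k => exact (min_le_right _ _).trans (hk1 k)
  refine ⟨1 / m, by positivity, fun k => ?_⟩
  have hp := hm0.trans_le (hk k)
  have hf : (0:ℝ) < Nat.factorial k := by positivity
  rw [bC, abs_div, abs_pow, abs_neg, abs_one, one_pow, abs_mul, abs_of_pos hp, abs_of_pos hf,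
    div_div, mul_comm]
  gcongr
  exact hk k

lemma bC_summable (ν : ℝ) (hν : -1 < ν) (w : ℝ) : Summable (fun k : ℕ => bC ν k * w ^ k) := by
  obtain ⟨M, hM, h⟩ := bC_bound ν hν
  refine Summable.of_norm_bounded (g := fun k => M * (|w| ^ k / Nat.factorial k))
    ((Real.summable_pow_div_factorial |w|).mul_left M) (fun k => ?_)
  rw [Real.norm_eq_abs, abs_mul, abs_pow]
  calc _ ≤ M / Nat.factorial k * |w| ^ k := by gcongr; exact h k
    _ = _ := by ring

lemma bC_succ (ν : ℝ) (k : ℕ) : bC ν (k + 1) * (k + 1) = - bC (ν + 1) k := by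
  unfold bC
  rw [Nat.factorial_succ]
  have : ν + ((k + 1 : ℕ) : ℝ) + 1 = ν + 1 + k + 1 := by push_cast; ring
  rw [this, pow_succ]
  have h1 : ((k : ℝ) + 1) ≠ 0 := by positivity
  have h2 : (Nat.factorial k : ℝ) ≠ 0 := by positivity
  push_cast
  by_cases h3 : Real.Gamma (ν + 1 + k + 1) = 0
  · simp [h3]
  · field_simp

lemma bG_hasDerivAt (ν : ℝ) (hν : -1 < ν) (w : ℝ) : HasDerivAt (bG ν) (- bG (ν + 1) w) w := by
  obtain ⟨M, hM, h⟩ := bC_bound ν hν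
  set R := |w| + 1 with hR
  have hR0 : 0 < R := by positivity
  have hs : Summable (fun k : ℕ => M / Nat.factorial k * (k * R ^ (k - 1))) := by
    rw [← summable_nat_add_iff 1]
    refine ((Real.summable_pow_div_factorial R).mul_left M).congr (fun k => ?_)
    rw [Nat.factorial_succ]
    have h1 : ((k : ℝ) + 1) ≠ 0 := by positivity
    have h2 : (Nat.factorial k : ℝ) ≠ 0 := by positivity
    push_cast
    field_simp
  have key := hasDerivAt_tsum_of_isPreconnected (𝕜 := ℝ) (F := ℝ)
    (g := fun k w => bC ν k * w ^ k)
    (g' := fun k w => bC ν k * (k * w ^ (k - 1))) (t := Metric.ball 0 R) (y₀ := 0) (y := w)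
    hs Metric.isOpen_ball (convex_ball _ _).isPreconnected
    (fun k y _ => (hasDerivAt_pow k y).const_mul _)
    (fun k y hy => by
      rw [Real.norm_eq_abs, abs_mul, abs_mul, abs_pow, Nat.abs_cast]
      have : |y| ≤ R := by
        simpa using (Metric.mem_ball.1 hy).le
      gcongr
      exact h k) (Metric.mem_ball_self hR0) (bC_summable ν hν 0)
    (by simp [hR])
  have e : ∑' k : ℕ, bC ν k * (k * w ^ (k - 1)) = - bG (ν + 1) w := by
    have hs' : Summable (fun k : ℕ => bC ν k * (k * w ^ (k - 1))) := by
      refine Summable.of_norm_bounded hs (fun k => ?_)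
      rw [Real.norm_eq_abs, abs_mul, abs_mul, abs_pow, Nat.abs_cast]
      have : |w| ≤ R := by simp [hR]
      gcongr
      exact h k
    rw [hs'.tsum_eq_zero_add, bG, ← tsum_neg]
    simp only [Nat.cast_zero, zero_mul, mul_zero, zero_add]
    refine tsum_congr (fun k => ?_)
    rw [← neg_mul, ← bC_succ]
    push_cast
    ring
  rw [e] at key
  exact key

lemma bG_rec (ν : ℝ) (hν : -1 < ν) (w : ℝ) :
    bG ν w = (ν + 1) * bG (ν + 1) w - w * bG (ν + 2) w := by
  have s1 := bC_summable (ν + 1) (by linarith) w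
  have s2 := bC_summable (ν + 2) (by linarith) w
  have hz : w * bG (ν + 2) w = - ∑' k : ℕ, bC (ν + 1) k * k * w ^ k := by
    have e : ∀ k : ℕ, bC (ν + 1) (k + 1) * ((k + 1 : ℕ) : ℝ) * w ^ (k + 1)
        = - (w * (bC (ν + 2) k * w ^ k)) := by
      intro k
      have := bC_succ (ν + 1) k
      rw [show ν + 1 + 1 = ν + 2 by ring] at this
      push_cast
      rw [this]; ring
    have s3 : Summable (fun k : ℕ => bC (ν + 1) k * k * w ^ k) := by
      rw [← summable_nat_add_iff 1]
      exact ((s2.mul_left w).neg).congr (fun k => (e k).symm)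
    rw [s3.tsum_eq_zero_add, bG, ← tsum_mul_left]
    simp only [Nat.cast_zero, zero_mul, mul_zero, zero_add]
    rw [tsum_congr e, tsum_neg, neg_neg]
  have s3 : Summable (fun k : ℕ => bC (ν + 1) k * k * w ^ k) := by
      have := bC_summable ν hν w
      refine (this.sub (s1.mul_left (ν + 1))).congr (fun k => ?_)
      have hk : (0:ℝ) ≤ k := Nat.cast_nonneg k
      unfold bC
      have : ν + 1 + k + 1 = (ν + k + 1) + 1 := by ring
      have h0 : ν + k + 1 ≠ 0 := by linarith
      rw [this, Real.Gamma_add_one h0]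
      have h3 := (Real.Gamma_pos_of_pos (s := ν + k + 1) (by linarith)).ne'
      field_simp
      ring
  rw [hz, sub_neg_eq_add, bG, bG, ← tsum_mul_left, ← (s1.mul_left (ν+1)).tsum_add s3]
  refine tsum_congr (fun k => ?_)
  have hk : (0:ℝ) ≤ k := Nat.cast_nonneg k
  unfold bC
  have : ν + 1 + k + 1 = (ν + k + 1) + 1 := by ring
  have h0 : ν + k + 1 ≠ 0 := by linarith
  rw [this, Real.Gamma_add_one h0]
  have h3 := (Real.Gamma_pos_of_pos (s := ν + k + 1) (by linarith)).ne'
  field_simp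
  ring

lemma besselJ_eq (ν : ℝ) {z : ℝ} (hz : 0 < z) :
    besselJ ν z = (z / 2) ^ ν * bG ν (z ^ 2 / 4) := by
  unfold besselJ bG bC
  rw [← tsum_mul_left]
  refine tsum_congr (fun k => ?_)
  rw [Real.rpow_add (by positivity), show z ^ 2 / 4 = (z / 2) ^ 2 by ring, ← pow_mul,
    show (2 * (k : ℝ)) = ((2 * k : ℕ) : ℝ) by push_cast; ring, Real.rpow_natCast]
  ring

lemma besselJ_rec (ν : ℝ) (hν : -1 < ν) {z : ℝ} (hz : 0 < z) :
    besselJ ν z = 2 * (ν + 1) / z * besselJ (ν + 1) z - besselJ (ν + 2) z := by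
  rw [besselJ_eq _ hz, besselJ_eq _ hz, besselJ_eq _ hz, bG_rec ν hν,
    Real.rpow_add (by positivity), Real.rpow_add (by positivity), Real.rpow_one,
    show (2:ℝ) = ((2:ℕ):ℝ) by norm_num, Real.rpow_natCast]
  push_cast
  field_simp
  ring

/-- derivative of `J_ν` -/
lemma besselJ_deriv (ν : ℝ) (hν : -1 < ν) {z : ℝ} (hz : 0 < z) :
    HasDerivAt (besselJ ν) (ν / z * besselJ ν z - besselJ (ν + 1) z) z := by
  have h1 : HasDerivAt (fun z : ℝ => (z / 2) ^ ν * bG ν (z ^ 2 / 4))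
      (ν / z * besselJ ν z - besselJ (ν + 1) z) z := by
    have a := ((hasDerivAt_id z).div_const 2).rpow_const (p := ν)
      (Or.inl (by simp; positivity))
    have b := (bG_hasDerivAt ν hν (z ^ 2 / 4)).comp z (((hasDerivAt_pow 2 z).div_const 4))
    convert! a.mul b using 1
    rw [besselJ_eq _ hz, besselJ_eq _ hz, Real.rpow_add (by positivity), Real.rpow_one]
    simp only [id, Function.comp]
    rw [Real.rpow_sub_one (by positivity)]
    field_simp
    simp
    ring
  refine h1.congr_of_eventuallyEq ?_
  filter_upwards [lt_mem_nhds hz] with y hy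
  exact besselJ_eq ν hy

lemma besselJ_deriv_succ (ν : ℝ) (hν : -1 < ν) {z : ℝ} (hz : 0 < z) :
    HasDerivAt (besselJ (ν + 1)) (besselJ ν z - (ν + 1) / z * besselJ (ν + 1) z) z := by
  have h := besselJ_deriv (ν + 1) (by linarith) hz
  convert h using 1
  rw [besselJ_rec ν hν hz, show ν + 1 + 1 = ν + 2 by ring]
  ring

lemma gamma_half (k : ℕ) :
    Real.Gamma (k + 1 / 2) * 4 ^ k * Nat.factorial k = Nat.factorial (2 * k) * Real.sqrt Real.pi := by
  induction k with
  | zero => simp [← Real.Gamma_one_half_eq]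
  | succ k ih =>
    have hk : (k : ℝ) + 1 / 2 ≠ 0 := by positivity
    rw [show ((k + 1 : ℕ) : ℝ) + 1 / 2 = (k + 1 / 2) + 1 by push_cast; ring,
      Real.Gamma_add_one hk, Nat.factorial_succ, show 2 * (k + 1) = (2 * k + 1) + 1 by ring,
      Nat.factorial_succ, Nat.factorial_succ]
    push_cast
    linear_combination ((k : ℝ) + 1 / 2) * 4 * (k + 1) * ih

lemma real_beta (a b : ℝ) (ha : 0 < a) (hb : 0 < b) :
    ∫ v in (0:ℝ)..1, v ^ (a - 1) * (1 - v) ^ (b - 1) =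
      Real.Gamma a * Real.Gamma b / Real.Gamma (a + b) := by
  have h := Complex.betaIntegral_eq_Gamma_mul_div (a : ℂ) (b : ℂ) (by simpa) (by simpa)
  apply Complex.ofReal_injective
  rw [← intervalIntegral.integral_ofReal]
  push_cast
  rw [← Complex.Gamma_ofReal, ← Complex.Gamma_ofReal, ← Complex.Gamma_ofReal]
  push_cast
  rw [← h, Complex.betaIntegral]
  refine intervalIntegral.integral_congr (fun v hv => ?_)
  rw [Set.uIcc_of_le zero_le_one] at hv
  rw [Complex.ofReal_cpow hv.1, Complex.ofReal_cpow (by linarith [hv.2])]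
  push_cast
  rfl

lemma one_sub_sq_cont (β : ℝ) (hβ : 0 < β) : Continuous (fun t : ℝ => (1 - t ^ 2) ^ β) :=
  (by fun_prop : Continuous (fun t : ℝ => 1 - t ^ 2)).rpow_const (fun _ => Or.inr hβ.le)

lemma moment (β : ℝ) (hβ : 0 < β) (k : ℕ) :
    ∫ t in (0:ℝ)..1, t ^ (2 * k) * (1 - t ^ 2) ^ β =
      1 / 2 * (Real.Gamma (k + 1 / 2) * Real.Gamma (β + 1) / Real.Gamma (k + 1 / 2 + (β + 1))) := by
  rw [← real_beta _ _ (by positivity) (by positivity)]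
  have hpt : ∀ t ∈ Set.Ioc (0:ℝ) 1, ((fun v : ℝ => v ^ ((k:ℝ) + 1 / 2 - 1) * (1 - v) ^ (β + 1 - 1)) ∘
      (fun t => t ^ 2)) t * (2 * t) = 2 * (t ^ (2 * k) * (1 - t ^ 2) ^ β) := by
    intro t ht
    simp only [Function.comp]
    rw [show β + 1 - 1 = β by ring]
    have : (t ^ 2) ^ ((k:ℝ) + 1 / 2 - 1) * t = t ^ (2 * k) := by
      rw [← Real.rpow_natCast t 2, ← Real.rpow_mul ht.1.le]
      nth_rewrite 2 [← Real.rpow_one t]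
      rw [← Real.rpow_add ht.1, ← Real.rpow_natCast]
      congr 1
      push_cast
      ring
    rw [← this]
    ring
  have hsub : Set.uIcc (0:ℝ) 1 = Set.Icc 0 1 := Set.uIcc_of_le zero_le_one
  have hc : Continuous (fun t : ℝ => 2 * (t ^ (2 * k) * (1 - t ^ 2) ^ β)) := by
    have := one_sub_sq_cont β hβ
    fun_prop
  have key := intervalIntegral.integral_comp_mul_deriv''' (a := 0) (b := 1) (f := fun t : ℝ => t ^ 2)
    (f' := fun t => 2 * t) (g := fun v : ℝ => v ^ ((k:ℝ) + 1 / 2 - 1) * (1 - v) ^ (β + 1 - 1))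
    (by fun_prop)
    (fun t _ => by simpa using (hasDerivAt_pow 2 t).hasDerivWithinAt)
    (by
      rintro v ⟨t, ht, rfl⟩
      simp only [zero_le_one, inf_of_le_left, sup_of_le_right] at ht
      apply ContinuousAt.continuousWithinAt
      have h1 : (fun t : ℝ => t ^ 2) t ≠ 0 := by have := ht.1; positivity
      have h2 : 1 - (fun t : ℝ => t ^ 2) t ≠ 0 := by
        have := ht.1; have := ht.2; simp only []; nlinarith
      exact (continuousAt_id.rpow_const (Or.inl h1)).mul
        ((continuousAt_const.sub continuousAt_id).rpow_const (Or.inl h2)))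
    (by
      have : Set.image (fun t : ℝ => t ^ 2) (Set.uIcc 0 1) ⊆ Set.Icc 0 1 := by
        rw [hsub]
        rintro v ⟨t, ht, rfl⟩
        have := ht.1; have := ht.2
        constructor
        · simp only []; positivity
        · simp only []; nlinarith
      refine MeasureTheory.IntegrableOn.mono_set ?_ this
      rw [← intervalIntegrable_iff_integrableOn_Icc_of_le zero_le_one]
      refine (intervalIntegral.intervalIntegrable_rpow' ?_).mul_continuousOn ?_
      · have : (0:ℝ) ≤ k := Nat.cast_nonneg k
        linarith
      · exact ((by fun_prop : Continuous (fun v : ℝ => 1 - v)).rpow_const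
          (fun _ => Or.inr (by linarith))).continuousOn)
    (by
      rw [hsub, integrableOn_Icc_iff_integrableOn_Ioc]
      refine (MeasureTheory.IntegrableOn.congr_fun ?_ (fun t ht => (hpt t ht).symm)
        measurableSet_Ioc)
      exact (hc.integrableOn_Icc).mono_set Set.Ioc_subset_Icc_self)
  simp only [ne_eq, OfNat.ofNat_ne_zero, not_false_eq_true, zero_pow, one_pow] at key
  rw [intervalIntegral.integral_congr_ae (g := fun t => 2 * (t ^ (2 * k) * (1 - t ^ 2) ^ β))
    (Filter.Eventually.of_forall (fun t ht => by
      rw [Set.uIoc_of_le zero_le_one] at ht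
      exact hpt t ht)), intervalIntegral.integral_const_mul] at key
  rw [← key]
  ring

/-- the cosine integral of the Poisson representation -/
def pInt (β z : ℝ) : ℝ := ∫ t in (0:ℝ)..1, (1 - t ^ 2) ^ β * Real.cos (z * t)

lemma poisson (β : ℝ) (hβ : 0 < β) (z : ℝ) :
    pInt β z = Real.sqrt Real.pi / 2 * Real.Gamma (β + 1) * bG (β + 1 / 2) (z ^ 2 / 4) := by
  have hs : HasSum (fun k : ℕ => ∫ t in (0:ℝ)..1,
      (1 - t ^ 2) ^ β * ((-1) ^ k * (z * t) ^ (2 * k) / Nat.factorial (2 * k))) (pInt β z) := by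
    refine intervalIntegral.hasSum_integral_of_dominated_convergence
      (fun k _ => z ^ (2 * k) / Nat.factorial (2 * k)) ?_ ?_ ?_ ?_ ?_
    · intro k
      have := one_sub_sq_cont β hβ
      exact (by fun_prop : Continuous _).aestronglyMeasurable
    · intro k
      refine Filter.Eventually.of_forall (fun t ht => ?_)
      rw [Set.uIoc_of_le zero_le_one] at ht
      have h0 : 0 ≤ 1 - t ^ 2 := by nlinarith [ht.1, ht.2]
      have h1 : (1 - t ^ 2) ^ β ≤ 1 := Real.rpow_le_one h0 (by nlinarith [ht.1]) hβ.le
      have h1' : 0 ≤ (1 - t ^ 2) ^ β := Real.rpow_nonneg h0 _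
      have h2 : t ^ (2 * k) ≤ 1 := pow_le_one₀ ht.1.le ht.2
      have h3 : 0 ≤ t ^ (2 * k) := pow_nonneg ht.1.le _
      have h4 : 0 ≤ z ^ (2 * k) := by rw [pow_mul]; positivity
      rw [Real.norm_eq_abs, abs_mul, abs_div, abs_mul, abs_pow, abs_neg, abs_one, one_pow, one_mul,
        mul_pow, abs_mul, abs_of_nonneg h1', abs_of_nonneg h3, abs_of_nonneg h4, Nat.abs_cast]
      calc _ ≤ 1 * (z ^ (2 * k) * 1 / (Nat.factorial (2 * k) : ℝ)) := by gcongr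
        _ = _ := by ring
    · exact Filter.Eventually.of_forall (fun t _ => (Real.hasSum_cosh z).summable)
    · exact intervalIntegrable_const
    · exact Filter.Eventually.of_forall (fun t _ => (Real.hasSum_cos (z * t)).mul_left _)
  rw [← hs.tsum_eq, bG, ← tsum_mul_left]
  refine tsum_congr (fun k => ?_)
  have e : ∀ t : ℝ, (1 - t ^ 2) ^ β * ((-1) ^ k * (z * t) ^ (2 * k) / Nat.factorial (2 * k))
      = ((-1) ^ k * z ^ (2 * k) / Nat.factorial (2 * k)) * (t ^ (2 * k) * (1 - t ^ 2) ^ β) := by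
    intro t; rw [mul_pow]; ring
  simp_rw [e]
  rw [intervalIntegral.integral_const_mul, moment β hβ, bC,
    show (k:ℝ) + 1 / 2 + (β + 1) = β + 1 / 2 + k + 1 by ring]
  have hg := gamma_half k
  have hk : (0:ℝ) ≤ k := Nat.cast_nonneg k
  have h1 : Real.Gamma (β + 1 / 2 + k + 1) ≠ 0 := (Real.Gamma_pos_of_pos (by linarith)).ne'
  have h2 : (Nat.factorial k : ℝ) ≠ 0 := by positivity
  have h3 : (Nat.factorial (2 * k) : ℝ) ≠ 0 := by positivity
  rw [show (z ^ 2 / 4) ^ k = z ^ (2 * k) / 4 ^ k by rw [div_pow, pow_mul]]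
  have h4 : Real.Gamma (k + 1 / 2) = Nat.factorial (2 * k) * Real.sqrt Real.pi / (4 ^ k * Nat.factorial k) := by
    rw [eq_div_iff (by positivity), ← hg]; ring
  rw [h4]
  field_simp

lemma watson (β : ℝ) (hβ : 0 < β) (h : ℝ → ℂ) (hc : Continuous h) :
    Tendsto (fun z : ℝ => ((z ^ (β + 1) : ℝ) : ℂ) *
      ∫ y in (0:ℝ)..1, ((Real.exp (-(z * y)) * y ^ β : ℝ) : ℂ) * h y) atTop
      (nhds ((Real.Gamma (β + 1) : ℂ) * h 0)) := by
  obtain ⟨C, hC⟩ := isCompact_Icc.exists_bound_of_continuousOn (s := Set.Icc (0:ℝ) 1) hc.continuousOn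
  have hG : MeasureTheory.IntegrableOn (fun r : ℝ => Real.exp (-r) * r ^ β) (Set.Ioi 0) := by
    simpa using Real.GammaIntegral_convergent (s := β + 1) (by linarith)
  have lim : (Real.Gamma (β + 1) : ℂ) * h 0 =
      ∫ r in Set.Ioi (0:ℝ), ((Real.exp (-r) * r ^ β : ℝ) : ℂ) * h 0 := by
    rw [MeasureTheory.integral_mul_const, integral_complex_ofReal, Real.Gamma_eq_integral (by linarith)]
    simp
  rw [lim]
  have key : Tendsto (fun z : ℝ => ∫ r in Set.Ioi (0:ℝ), (Set.Ioc 0 z).indicator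
      (fun r => ((Real.exp (-r) * r ^ β : ℝ) : ℂ) * h (r / z)) r) atTop
      (nhds (∫ r in Set.Ioi (0:ℝ), ((Real.exp (-r) * r ^ β : ℝ) : ℂ) * h 0)) := by
    refine MeasureTheory.tendsto_integral_filter_of_dominated_convergence
      (fun r => (Real.exp (-r) * r ^ β) * C) ?_ ?_ (hG.mul_const C) ?_
    · refine Filter.Eventually.of_forall (fun z => ?_)
      refine MeasureTheory.AEStronglyMeasurable.indicator ?_ measurableSet_Ioc
      have : Continuous (fun r : ℝ => r ^ β) := Real.continuous_rpow_const hβ.le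
      exact (by fun_prop : Continuous _).aestronglyMeasurable
    · filter_upwards [eventually_gt_atTop 0] with z hz
      refine (MeasureTheory.ae_restrict_iff' measurableSet_Ioi).2 (Filter.Eventually.of_forall ?_)
      intro r hr
      have hr : 0 < r := hr
      have hC0 : 0 ≤ C := (norm_nonneg _).trans (hC 0 (by simp))
      by_cases hrz : r ∈ Set.Ioc 0 z
      · rw [Set.indicator_of_mem hrz, norm_mul, Complex.norm_real, Real.norm_eq_abs,
          abs_of_nonneg (by positivity)]
        gcongr
        exact hC _ ⟨by positivity, (div_le_one hz).2 hrz.2⟩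
      · rw [Set.indicator_of_notMem hrz, norm_zero]; positivity
    · refine (MeasureTheory.ae_restrict_iff' measurableSet_Ioi).2 (Filter.Eventually.of_forall ?_)
      intro r hr
      have h1 : Tendsto (fun z : ℝ => ((Real.exp (-r) * r ^ β : ℝ) : ℂ) * h (r / z)) atTop
          (nhds (((Real.exp (-r) * r ^ β : ℝ) : ℂ) * h 0)) := by
        refine Tendsto.const_mul _ ?_
        exact (hc.tendsto 0).comp (tendsto_const_nhds.div_atTop tendsto_id)
      refine h1.congr' ?_
      filter_upwards [eventually_ge_atTop r] with z hz
      rw [Set.indicator_of_mem (Set.mem_Ioc.2 ⟨hr, hz⟩)]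
  refine key.congr' ?_
  filter_upwards [eventually_gt_atTop 0] with z hz
  rw [MeasureTheory.setIntegral_indicator measurableSet_Ioc,
    Set.inter_eq_right.2 Set.Ioc_subset_Ioi_self, ← intervalIntegral.integral_of_le hz.le]
  have := intervalIntegral.integral_comp_mul_left (a := 0) (b := 1) (c := z)
    (fun r => ((Real.exp (-r) * r ^ β : ℝ) : ℂ) * h (r / z)) hz.ne'
  rw [mul_zero, mul_one] at this
  have h2 : ∫ r in (0:ℝ)..z, ((Real.exp (-r) * r ^ β : ℝ) : ℂ) * h (r / z) =
      (z : ℂ) * ∫ y in (0:ℝ)..1, ((Real.exp (-(z * y)) * (z * y) ^ β : ℝ) : ℂ) * h (z * y / z) := by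
    rw [this, Complex.real_smul, ← mul_assoc]
    push_cast
    rw [mul_inv_cancel₀ (by exact_mod_cast hz.ne'), one_mul]
  rw [h2, ← intervalIntegral.integral_const_mul, ← intervalIntegral.integral_const_mul]
  refine intervalIntegral.integral_congr (fun y hy => ?_)
  rw [Set.uIcc_of_le zero_le_one] at hy
  rw [mul_div_cancel_left₀ _ hz.ne', Real.mul_rpow hz.le hy.1, Real.rpow_add_one hz.ne']
  push_cast
  ring

lemma real_mul_cpow' {a : ℝ} (ha : 0 ≤ a) (b r : ℂ) :
    ((a : ℂ) * b) ^ r = (a : ℂ) ^ r * b ^ r := by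
  by_cases hr : r = 0
  · simp [hr]
  rcases ha.eq_or_lt with rfl | ha
  · simp [Complex.zero_cpow hr]
  by_cases hb : b = 0
  · simp [hb, Complex.zero_cpow hr]
  have ha' : (a : ℂ) ≠ 0 := by exact_mod_cast ha.ne'
  rw [Complex.cpow_def_of_ne_zero (mul_ne_zero ha' hb), Complex.cpow_def_of_ne_zero ha',
    Complex.cpow_def_of_ne_zero hb, Complex.log_ofReal_mul ha hb, ← Complex.exp_add,
    Complex.ofReal_log ha.le]
  ring_nf

lemma one_sub_sq_re (w : ℂ) : (1 - w ^ 2).re = 1 - w.re ^ 2 + w.im ^ 2 := by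
  simp [pow_two]; ring

/-- the integrand of the contour integral -/
def cF (β z : ℝ) (w : ℂ) : ℂ := (1 - w ^ 2) ^ (β : ℂ) * Complex.exp (Complex.I * z * w)

lemma cF_cont (β z : ℝ) (hβ : 0 < β) :
    ContinuousOn (cF β z) (Set.uIcc (0:ℂ).re (1 + Complex.I).re ×ℂ Set.uIcc (0:ℂ).im (1 + Complex.I).im) := by
  intro w hw
  apply ContinuousAt.continuousWithinAt
  have hw1 : w.re ∈ Set.Icc (0:ℝ) 1 := by
    have := hw.1; simpa [Set.uIcc_of_le] using this
  have h1 : ContinuousAt (fun w : ℂ => Complex.exp (Complex.I * z * w)) w := by fun_prop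
  have h0 : ContinuousAt (fun w : ℂ => 1 - w ^ 2) w := by fun_prop
  refine ContinuousAt.mul ?_ h1
  have hre := one_sub_sq_re w
  by_cases h : 1 - w ^ 2 = 0
  · have : ContinuousAt (fun u : ℂ => u ^ (β : ℂ)) (1 - w ^ 2) := by
      rw [h]
      exact Complex.continuousAt_cpow_const_of_re_pos (Or.inl le_rfl) (by simpa using hβ)
    exact ContinuousAt.comp (f := fun w : ℂ => 1 - w ^ 2) this h0
  · have hn : 0 ≤ (1 - w ^ 2).re := by
      rw [hre]; nlinarith [hw1.1, hw1.2, sq_nonneg w.im]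
    have : ContinuousAt (fun u : ℂ => u ^ (β : ℂ)) (1 - w ^ 2) :=
      Complex.continuousAt_cpow_const_of_re_pos (Or.inl hn) (by simpa using hβ)
    exact ContinuousAt.comp (f := fun w : ℂ => 1 - w ^ 2) this h0

lemma cF_diff (β z : ℝ) :
    DifferentiableOn ℂ (cF β z) (Set.Ioo (min (0:ℂ).re (1 + Complex.I).re) (max (0:ℂ).re (1 + Complex.I).re) ×ℂ
      Set.Ioo (min (0:ℂ).im (1 + Complex.I).im) (max (0:ℂ).im (1 + Complex.I).im)) := by
  intro w hw
  have hw1 : w.re ∈ Set.Ioo (0:ℝ) 1 := by simpa using hw.1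
  apply DifferentiableAt.differentiableWithinAt
  unfold cF
  refine DifferentiableAt.mul ?_ (by fun_prop)
  refine DifferentiableAt.cpow (by fun_prop) (by fun_prop) ?_
  left
  rw [one_sub_sq_re]
  nlinarith [hw1.1, hw1.2, sq_nonneg w.im]

lemma contour (β z : ℝ) (hβ : 0 < β) :
    pInt β z = (∫ x in (0:ℝ)..1, cF β z (x + Complex.I)).re
      + (∫ y in (0:ℝ)..1, cF β z (1 + y * Complex.I)).im := by
  have h := Complex.integral_boundary_rect_eq_zero_of_continuousOn_of_differentiableOn (cF β z) 0
    (1 + Complex.I) (cF_cont β z hβ) (cF_diff β z)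
  simp only [Complex.zero_re, Complex.zero_im, Complex.add_re, Complex.add_im, Complex.one_re,
    Complex.one_im, Complex.I_re, Complex.I_im, add_zero, zero_add, Complex.ofReal_zero, zero_mul,
    Complex.ofReal_one, one_mul, smul_eq_mul] at h
  have e1 : (∫ x in (0:ℝ)..1, cF β z x).re = pInt β z := by
    have hi : IntervalIntegrable (fun x : ℝ => cF β z x) MeasureTheory.volume 0 1 := by
      apply ContinuousOn.intervalIntegrable
      refine (cF_cont β z hβ).comp (by fun_prop) ?_
      intro x hx
      rw [Complex.mem_reProdIm]
      simpa using hx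
    have := (Complex.reCLM.intervalIntegral_comp_comm hi)
    simp only [Complex.reCLM_apply] at this
    rw [← this, pInt]
    refine intervalIntegral.integral_congr (fun x hx => ?_)
    rw [Set.uIcc_of_le zero_le_one] at hx
    have h0 : (0:ℝ) ≤ 1 - x ^ 2 := by nlinarith [hx.1, hx.2]
    show (cF β z x).re = _
    rw [cF, show (1 - (x:ℂ) ^ 2) = ((1 - x ^ 2 : ℝ) : ℂ) by push_cast; ring, ← Complex.ofReal_cpow h0,
      Complex.re_ofReal_mul, show Complex.I * z * x = ((z * x : ℝ) : ℂ) * Complex.I by push_cast; ring,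
      Complex.exp_ofReal_mul_I_re]
  have e2 : (∫ y in (0:ℝ)..1, cF β z (y * Complex.I)) =
      ((∫ y in (0:ℝ)..1, (1 + y ^ 2) ^ β * Real.exp (-(z * y)) : ℝ) : ℂ) := by
    rw [← intervalIntegral.integral_ofReal]
    refine intervalIntegral.integral_congr (fun y hy => ?_)
    show cF β z (y * Complex.I) = _
    rw [cF, mul_pow, Complex.I_sq, show (1 - (y:ℂ) ^ 2 * -1) = ((1 + y ^ 2 : ℝ) : ℂ) by push_cast; ring,
      ← Complex.ofReal_cpow (by positivity),
      show Complex.I * z * (y * Complex.I) = ((-(z * y) : ℝ) : ℂ) by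
        push_cast; linear_combination (z * y : ℂ) * Complex.I_sq]
    push_cast
    rfl
  have h2 := congrArg Complex.re h
  rw [e2] at h2
  simp only [Complex.add_re, Complex.sub_re, Complex.mul_re, Complex.I_re, Complex.I_im,
    Complex.ofReal_re, Complex.ofReal_im, Complex.zero_re] at h2
  rw [e1] at h2
  linarith

lemma top_bound (β : ℝ) (hβ : 0 < β) : ∃ C : ℝ, ∀ z : ℝ,
    ‖∫ x in (0:ℝ)..1, cF β z (x + Complex.I)‖ ≤ C * Real.exp (-z) := by
  have hc : ContinuousOn (fun x : ℝ => cF β 0 (x + Complex.I)) (Set.Icc 0 1) := by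
    refine (cF_cont β 0 hβ).comp (by fun_prop) ?_
    intro x hx
    rw [Complex.mem_reProdIm]
    simpa using hx
  obtain ⟨C, hC⟩ := isCompact_Icc.exists_bound_of_continuousOn hc
  refine ⟨C, fun z => ?_⟩
  have := intervalIntegral.norm_integral_le_of_norm_le_const (a := 0) (b := 1)
    (f := fun x : ℝ => cF β z (x + Complex.I)) (C := C * Real.exp (-z)) (fun x hx => by
      rw [Set.uIoc_of_le zero_le_one] at hx
      have h := hC x ⟨hx.1.le, hx.2⟩
      have e : cF β z (x + Complex.I) = cF β 0 (x + Complex.I) * Complex.exp (Complex.I * z * (x + Complex.I)) := by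
        simp [cF]
      rw [e, norm_mul, Complex.norm_exp]
      have : (Complex.I * z * (x + Complex.I)).re = -z := by simp
      rw [this]
      gcongr)
  simpa using this

lemma pInt_asymp (β : ℝ) (hβ : 0 < β) :
    Tendsto (fun z : ℝ => z ^ (β + 1) * pInt β z -
      Real.Gamma (β + 1) * 2 ^ β * Real.cos (z - Real.pi * (β + 1) / 2)) atTop (nhds 0) := by
  set h : ℝ → ℂ := fun y : ℝ => ((y : ℂ) - 2 * Complex.I) ^ (β : ℂ) with hh
  have hcont : Continuous h := by
    refine Continuous.cpow (by fun_prop) (by fun_prop) (fun y => ?_)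
    right
    simp
  have hw := watson β hβ h hcont
  obtain ⟨C, hC⟩ := top_bound β hβ
  set W : ℝ → ℂ := fun z => ((z ^ (β + 1) : ℝ) : ℂ) *
      ∫ y in (0:ℝ)..1, ((Real.exp (-(z * y)) * y ^ β : ℝ) : ℂ) * h y with hW
  have hR : ∀ z : ℝ, ((z ^ (β + 1) : ℝ) : ℂ) * ∫ y in (0:ℝ)..1, cF β z (1 + y * Complex.I)
      = Complex.exp (z * Complex.I) * W z := by
    intro z
    rw [hW]
    simp only []
    rw [mul_left_comm]
    congr 1
    rw [← intervalIntegral.integral_const_mul]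
    refine intervalIntegral.integral_congr (fun y hy => ?_)
    rw [Set.uIcc_of_le zero_le_one] at hy
    show cF β z (1 + y * Complex.I) = _
    rw [cF, show (1 - (1 + (y:ℂ) * Complex.I) ^ 2) = (y : ℂ) * ((y : ℂ) - 2 * Complex.I) by
        linear_combination (-(y:ℂ) ^ 2) * Complex.I_sq,
      real_mul_cpow' hy.1,
      show Complex.I * z * (1 + y * Complex.I) = z * Complex.I + ((-(z * y) : ℝ) : ℂ) by
        push_cast; linear_combination (z * y : ℂ) * Complex.I_sq, Complex.exp_add]
    rw [← Complex.ofReal_cpow hy.1]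
    push_cast
    ring
  have hh0 : h 0 = ((2 ^ β : ℝ) : ℂ) * Complex.exp ((-(Real.pi * β / 2) : ℝ) * Complex.I) := by
    rw [hh]
    simp only []
    rw [show ((0:ℝ):ℂ) - 2 * Complex.I = ((2:ℝ):ℂ) * (-Complex.I) by push_cast; ring,
      real_mul_cpow' (by norm_num), ← Complex.ofReal_cpow (by norm_num),
      Complex.cpow_def_of_ne_zero (by simp), Complex.log_neg_I]
    congr 2
    push_cast
    ring
  have t1 : Tendsto (fun z : ℝ => (Complex.exp (z * Complex.I) *
      (W z - (Real.Gamma (β + 1) : ℂ) * h 0)).im) atTop (nhds 0) := by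
    have : Tendsto (fun z : ℝ => ‖W z - (Real.Gamma (β + 1) : ℂ) * h 0‖) atTop (nhds 0) := by
      have := (hw.sub_const ((Real.Gamma (β + 1) : ℂ) * h 0)).norm
      simpa using this
    refine squeeze_zero_norm (fun z => ?_) this
    refine (Complex.abs_im_le_norm _).trans ?_
    rw [norm_mul, Complex.norm_exp_ofReal_mul_I, one_mul]
  have t2 : Tendsto (fun z : ℝ => z ^ (β + 1) * (∫ x in (0:ℝ)..1, cF β z (x + Complex.I)).re)
      atTop (nhds 0) := by
    have h0 : Tendsto (fun z : ℝ => C * (z ^ (β + 1) * Real.exp (-1 * z))) atTop (nhds 0) := by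
      simpa using (tendsto_rpow_mul_exp_neg_mul_atTop_nhds_zero (β + 1) 1 one_pos).const_mul C
    refine squeeze_zero_norm' ?_ h0
    filter_upwards [eventually_gt_atTop 0] with z hz
    have := (Complex.abs_re_le_norm _).trans (hC z)
    rw [norm_mul, Real.norm_eq_abs, Real.norm_eq_abs, abs_of_pos (by positivity)]
    calc _ ≤ z ^ (β + 1) * (C * Real.exp (-z)) := by gcongr
      _ = _ := by rw [neg_one_mul]; ring
  have t3 := t2.add t1
  rw [add_zero] at t3
  refine t3.congr (fun z => ?_)
  rw [contour β z hβ, mul_add, mul_sub, ← hR z, Complex.sub_im, Complex.im_ofReal_mul, hh0]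
  have e : Complex.exp (z * Complex.I) * ((Real.Gamma (β + 1) : ℂ) * (((2 ^ β : ℝ) : ℂ) *
      Complex.exp ((-(Real.pi * β / 2) : ℝ) * Complex.I))) =
      ((Real.Gamma (β + 1) * 2 ^ β : ℝ) : ℂ) * Complex.exp ((z - Real.pi * β / 2 : ℝ) * Complex.I) := by
    rw [show ((z - Real.pi * β / 2 : ℝ) : ℂ) * Complex.I = z * Complex.I +
      (-(Real.pi * β / 2) : ℝ) * Complex.I by push_cast; ring, Complex.exp_add]
    push_cast
    ring
  rw [e, Complex.im_ofReal_mul, Complex.exp_ofReal_mul_I_im,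
    show z - Real.pi * (β + 1) / 2 = (z - Real.pi * β / 2) - Real.pi / 2 by ring,
    Real.cos_sub_pi_div_two]
  ring

/-- Leading order asymptotics of `J_ν`. -/
def Asym (ν : ℝ) : Prop :=
  Tendsto (fun z : ℝ => Real.sqrt z * besselJ ν z -
    Real.sqrt (2 / Real.pi) * Real.cos (z - (Real.pi * ν / 2 + Real.pi / 4))) atTop (nhds 0)

lemma asym_large (ν : ℝ) (hν : 1 / 2 < ν) : Asym ν := by
  have hβ : 0 < ν - 1 / 2 := by linarith
  have h := pInt_asymp (ν - 1 / 2) hβ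
  have hG : 0 < Real.Gamma (ν - 1 / 2 + 1) := Real.Gamma_pos_of_pos (by linarith)
  have hp := Real.pi_pos
  set K := 2 ^ (1 - ν) / (Real.sqrt Real.pi * Real.Gamma (ν - 1 / 2 + 1)) with hK
  have h2 := h.const_mul K
  rw [mul_zero] at h2
  refine h2.congr' ?_
  filter_upwards [eventually_gt_atTop 0] with z hz
  rw [poisson _ hβ, besselJ_eq _ hz, show ν - 1 / 2 + 1 / 2 = ν by ring,
    show Real.pi * (ν - 1 / 2 + 1) / 2 = Real.pi * ν / 2 + Real.pi / 4 by ring, mul_sub]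
  have hsp : 0 < Real.sqrt Real.pi := Real.sqrt_pos.2 hp
  congr 1
  · rw [hK, Real.sqrt_eq_rpow z, Real.div_rpow hz.le (by norm_num),
      show ν - 1 / 2 + 1 = 1 / 2 + ν by ring, Real.rpow_add hz, Real.rpow_sub (by norm_num),
      Real.rpow_one]
    rw [show ν - 1 / 2 + 1 = 1 / 2 + ν by ring] at hG
    have : (0:ℝ) < 2 ^ ν := by positivity
    field_simp
  · rw [hK, Real.sqrt_div (by norm_num), ← mul_assoc]
    congr 1
    have : (2:ℝ) ^ (1 - ν) * 2 ^ (ν - 1 / 2) = Real.sqrt 2 := by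
      rw [← Real.rpow_add (by norm_num), Real.sqrt_eq_rpow]; congr 1; ring
    rw [← this]
    generalize Real.Gamma (ν - 1 / 2 + 1) = g at hG
    field_simp

lemma asym_down (ν : ℝ) (hν : -1 < ν) (h1 : Asym (ν + 1)) (h2 : Asym (ν + 2)) : Asym ν := by
  unfold Asym at *
  have hb : Tendsto (fun z : ℝ => 2 * (ν + 1) / z * (Real.sqrt z * besselJ (ν + 1) z)) atTop (nhds 0) := by
    have a : Tendsto (fun z : ℝ => 2 * (ν + 1) / z) atTop (nhds 0) :=
      tendsto_const_nhds.div_atTop tendsto_id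
    have b := a.mul h1
    have c : Tendsto (fun z : ℝ => 2 * (ν + 1) / z * (Real.sqrt (2 / Real.pi) *
        Real.cos (z - (Real.pi * (ν + 1) / 2 + Real.pi / 4)))) atTop (nhds 0) := by
      have a' := (a.norm).mul_const (Real.sqrt (2 / Real.pi))
      rw [norm_zero, zero_mul] at a'
      refine squeeze_zero_norm (fun z => ?_) a'
      rw [norm_mul, norm_mul, Real.norm_eq_abs (Real.sqrt _), abs_of_nonneg (Real.sqrt_nonneg _)]
      have := Real.abs_cos_le_one (z - (Real.pi * (ν + 1) / 2 + Real.pi / 4))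
      rw [← Real.norm_eq_abs] at this
      have h3 := mul_le_of_le_one_right (Real.sqrt_nonneg (2 / Real.pi)) this
      gcongr
    have := b.add c
    rw [mul_zero, add_zero] at this
    refine this.congr (fun z => ?_)
    ring
  have := hb.sub h2
  rw [sub_zero] at this
  refine this.congr' ?_
  filter_upwards [eventually_gt_atTop 0] with z hz
  rw [besselJ_rec ν hν hz, show z - (Real.pi * (ν + 2) / 2 + Real.pi / 4) =
    z - (Real.pi * ν / 2 + Real.pi / 4) - Real.pi by ring, Real.cos_sub_pi]
  ring

lemma asym (ν : ℝ) (hν : -1 < ν) : Asym ν := by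
  have h2 := asym_large (ν + 2) (by linarith)
  have h3 := asym_large (ν + 3) (by linarith)
  have h1 := asym_down (ν + 1) (by linarith) (by convert h2 using 1; ring) (by convert h3 using 1; ring)
  exact asym_down ν hν h1 h2

lemma prod_asym {f g F G : ℝ → ℝ} (hf : Tendsto (fun z => f z - F z) atTop (nhds 0))
    (hg : Tendsto (fun z => g z - G z) atTop (nhds 0)) (K : ℝ) (hF : ∀ z, |F z| ≤ K)
    (hG : ∀ z, |G z| ≤ K) : Tendsto (fun z => f z * g z - F z * G z) atTop (nhds 0) := by
  have h1 := hf.mul hg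
  have h2 : Tendsto (fun z => F z * (g z - G z)) atTop (nhds 0) := by
    have := (hg.norm).const_mul K
    rw [norm_zero, mul_zero] at this
    refine squeeze_zero_norm (fun z => ?_) this
    rw [norm_mul]
    gcongr
    exact hF z
  have h3 : Tendsto (fun z => (f z - F z) * G z) atTop (nhds 0) := by
    have := (hf.norm).mul_const K
    rw [norm_zero, zero_mul] at this
    refine squeeze_zero_norm (fun z => ?_) this
    rw [norm_mul]
    gcongr
    exact hG z
  have := (h1.add h2).add h3
  simp only [mul_zero, add_zero] at this
  refine this.congr (fun z => ?_)
  ring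

lemma decay {f f' : ℝ → ℝ} {L D Z : ℝ} (hZ : 0 < Z) (hd : ∀ z, Z ≤ z → HasDerivAt f (f' z) z)
    (hb : ∀ z, Z ≤ z → |f' z| ≤ D / z ^ 3) (hL : Tendsto f atTop (nhds L)) :
    Tendsto (fun z => z / 2 * (f z - L)) atTop (nhds 0) := by
  have hq : ∀ z : ℝ, 0 < z → HasDerivAt (fun z : ℝ => D / (2 * z ^ 2)) (- D / z ^ 3) z := by
    intro z hz
    have h := ((hasDerivAt_pow 2 z).const_mul 2).inv (by positivity) |>.const_mul D
    refine (h.congr_of_eventuallyEq (Filter.Eventually.of_forall fun w => by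
      simp [div_eq_mul_inv])).congr_deriv ?_
    push_cast
    field_simp
  have hq0 : Tendsto (fun z : ℝ => D / (2 * z ^ 2)) atTop (nhds 0) := by
    refine tendsto_const_nhds.div_atTop ?_
    exact (tendsto_pow_atTop two_ne_zero).const_mul_atTop (by norm_num)
  have m1 : MonotoneOn (fun z => f z - D / (2 * z ^ 2)) (Set.Ici Z) := by
    have hder : ∀ z, Z ≤ z → HasDerivAt (fun z => f z - D / (2 * z ^ 2)) (f' z - - D / z ^ 3) z :=
      fun z hz => (hd z hz).sub (hq z (by linarith))
    refine monotoneOn_of_deriv_nonneg (convex_Ici Z)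
      (fun z hz => (hder z hz).continuousAt.continuousWithinAt)
      (fun z hz => (hder z (interior_subset hz)).differentiableAt.differentiableWithinAt) ?_
    intro z hz
    rw [(hder z (interior_subset hz)).deriv]
    have := (abs_le.1 (hb z (interior_subset hz))).1
    rw [neg_div]
    linarith
  have m2 : AntitoneOn (fun z => f z + D / (2 * z ^ 2)) (Set.Ici Z) := by
    have hder : ∀ z, Z ≤ z → HasDerivAt (fun z => f z + D / (2 * z ^ 2)) (f' z + - D / z ^ 3) z :=
      fun z hz => (hd z hz).add (hq z (by linarith))
    refine antitoneOn_of_deriv_nonpos (convex_Ici Z)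
      (fun z hz => (hder z hz).continuousAt.continuousWithinAt)
      (fun z hz => (hder z (interior_subset hz)).differentiableAt.differentiableWithinAt) ?_
    intro z hz
    rw [(hder z (interior_subset hz)).deriv]
    have := (abs_le.1 (hb z (interior_subset hz))).2
    rw [neg_div]
    linarith
  have key : ∀ z, Z ≤ z → |f z - L| ≤ D / (2 * z ^ 2) := by
    intro z hz
    have a1 : f z - D / (2 * z ^ 2) ≤ L := by
      have hl := hL.sub hq0
      rw [sub_zero] at hl
      refine ge_of_tendsto hl ?_
      filter_upwards [eventually_ge_atTop z] with w hw
      exact m1 hz (hz.trans hw) hw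
    have a2 : L ≤ f z + D / (2 * z ^ 2) := by
      have hl := hL.add hq0
      rw [add_zero] at hl
      refine le_of_tendsto hl ?_
      filter_upwards [eventually_ge_atTop z] with w hw
      exact m2 hz (hz.trans hw) hw
    rw [abs_le]
    constructor <;> linarith
  have hlim : Tendsto (fun z : ℝ => D / 4 / z) atTop (nhds 0) :=
    tendsto_const_nhds.div_atTop tendsto_id
  refine squeeze_zero_norm' ?_ hlim
  filter_upwards [eventually_ge_atTop Z] with z hz
  have hz0 : 0 < z := by linarith
  rw [norm_mul, Real.norm_eq_abs, Real.norm_eq_abs, abs_of_pos (by positivity)]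
  calc _ ≤ z / 2 * (D / (2 * z ^ 2)) := by gcongr; exact key z hz
    _ = _ := by field_simp; ring

/-- main term -/
def cc (ν z : ℝ) : ℝ := Real.sqrt (2 / Real.pi) * Real.cos (z - (Real.pi * ν / 2 + Real.pi / 4))
/-- main term -/
def ss (ν z : ℝ) : ℝ := Real.sqrt (2 / Real.pi) * Real.sin (z - (Real.pi * ν / 2 + Real.pi / 4))

lemma cc_bd (ν z : ℝ) : |cc ν z| ≤ Real.sqrt (2 / Real.pi) := by
  rw [cc, abs_mul, abs_of_nonneg (Real.sqrt_nonneg _)]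
  exact mul_le_of_le_one_right (Real.sqrt_nonneg _) (Real.abs_cos_le_one _)

lemma ss_bd (ν z : ℝ) : |ss ν z| ≤ Real.sqrt (2 / Real.pi) := by
  rw [ss, abs_mul, abs_of_nonneg (Real.sqrt_nonneg _)]
  exact mul_le_of_le_one_right (Real.sqrt_nonneg _) (Real.abs_sin_le_one _)

lemma asym_u (ν : ℝ) (hν : -1 < ν) :
    Tendsto (fun z : ℝ => Real.sqrt z * besselJ ν z - cc ν z) atTop (nhds 0) := asym ν hν

lemma asym_v (ν : ℝ) (hν : -1 < ν) :
    Tendsto (fun z : ℝ => Real.sqrt z * besselJ (ν + 1) z - ss ν z) atTop (nhds 0) := by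
  have h := asym (ν + 1) (by linarith)
  unfold Asym at h
  refine h.congr (fun z => ?_)
  rw [ss, show z - (Real.pi * (ν + 1) / 2 + Real.pi / 4) =
    z - (Real.pi * ν / 2 + Real.pi / 4) - Real.pi / 2 by ring, Real.cos_sub_pi_div_two]

lemma diag_asym (ν : ℝ) (hν : -1 < ν) :
    Tendsto (fun z : ℝ => z ^ 2 / 2 * (besselJ ν z ^ 2 + besselJ (ν + 1) z ^ 2)
      - ν * z * besselJ ν z * besselJ (ν + 1) z - z / Real.pi
      - Real.sin (2 * z - 2 * (Real.pi * ν / 2 + Real.pi / 4)) / (2 * Real.pi)) atTop (nhds 0) := by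
  set A := besselJ ν with hA
  set B := besselJ (ν + 1) with hB
  set a := ν + 1 / 2 with ha
  have hp := Real.pi_pos
  have hu := asym_u ν hν
  have hv := asym_v ν hν
  rw [← hA] at hu
  rw [← hB] at hv
  have c2 : Real.sqrt (2 / Real.pi) ^ 2 = 2 / Real.pi := Real.sq_sqrt (by positivity)
  have huu := prod_asym hu hu _ (cc_bd ν) (cc_bd ν)
  have huv := prod_asym hu hv _ (cc_bd ν) (ss_bd ν)
  have hvv := prod_asym hv hv _ (ss_bd ν) (ss_bd ν)
  have e0 : ∀ z : ℝ, 0 ≤ z → ∀ p q : ℝ, Real.sqrt z * p * (Real.sqrt z * q) = z * p * q := by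
    intro z hz p q
    linear_combination (p * q) * Real.mul_self_sqrt hz
  have huu' : Tendsto (fun z => z * A z * A z - cc ν z * cc ν z) atTop (nhds 0) := by
    refine huu.congr' ?_
    filter_upwards [eventually_ge_atTop 0] with z hz
    rw [e0 z hz]
  have huv' : Tendsto (fun z => z * A z * B z - cc ν z * ss ν z) atTop (nhds 0) := by
    refine huv.congr' ?_
    filter_upwards [eventually_ge_atTop 0] with z hz
    rw [e0 z hz]
  have hvv' : Tendsto (fun z => z * B z * B z - ss ν z * ss ν z) atTop (nhds 0) := by
    refine hvv.congr' ?_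
    filter_upwards [eventually_ge_atTop 0] with z hz
    rw [e0 z hz]
  have hinv : Tendsto (fun z : ℝ => z⁻¹) atTop (nhds 0) := tendsto_inv_atTop_zero
  have bdd : ∀ {f g : ℝ → ℝ} (K : ℝ), (∀ z, |g z| ≤ K) → Tendsto (fun z => f z - g z) atTop (nhds 0) →
      Tendsto (fun z => z⁻¹ * f z) atTop (nhds 0) := by
    intro f g K hg h
    have h1 := hinv.mul h
    have h2 : Tendsto (fun z : ℝ => z⁻¹ * g z) atTop (nhds 0) := by
      have := hinv.norm.mul_const K
      rw [norm_zero, zero_mul] at this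
      refine squeeze_zero_norm (fun z => ?_) this
      rw [norm_mul]
      gcongr
      exact hg z
    have := h1.add h2
    rw [mul_zero, add_zero] at this
    refine this.congr (fun z => by ring)
  have pb : ∀ p q : ℝ, |p| ≤ Real.sqrt (2 / Real.pi) → |q| ≤ Real.sqrt (2 / Real.pi) →
      |p * q| ≤ 2 / Real.pi := by
    intro p q h1 h2
    rw [abs_mul, ← c2, pow_two]
    gcongr
  have tuu := bdd _ (fun z => pb _ _ (cc_bd ν z) (cc_bd ν z)) huu'
  have tuv := bdd _ (fun z => pb _ _ (cc_bd ν z) (ss_bd ν z)) huv'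
  have tuu2 := hinv.mul tuu
  rw [mul_zero] at tuu2
  set E : ℝ → ℝ := fun z => z * A z ^ 2 + a * A z ^ 2 / z + z * B z ^ 2 - 2 * a * A z * B z with hE
  have hEl : Tendsto E atTop (nhds (2 / Real.pi)) := by
    have := (((huu'.add hvv').add (tuu2.const_mul a)).sub (tuv.const_mul (2 * a))).add_const (2 / Real.pi)
    simp only [mul_zero, add_zero, sub_zero, zero_add] at this
    refine this.congr' ?_
    filter_upwards [eventually_gt_atTop 0] with z hz
    rw [hE]
    have : cc ν z * cc ν z + ss ν z * ss ν z = 2 / Real.pi := by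
      rw [← c2, cc, ss]
      linear_combination Real.sqrt (2 / Real.pi) ^ 2 *
        Real.sin_sq_add_cos_sq (z - (Real.pi * ν / 2 + Real.pi / 4))
    rw [← this]
    field_simp
    ring
  have hEd : ∀ z : ℝ, 0 < z → HasDerivAt E (2 * a * (a - 1) * A z ^ 2 / z ^ 2) z := by
    intro z hz
    have dA : HasDerivAt A (ν / z * A z - B z) z := besselJ_deriv ν hν hz
    have dB : HasDerivAt B (A z - (ν + 1) / z * B z) z := besselJ_deriv_succ ν hν hz
    have did := hasDerivAt_id z
    have h := (((did.mul (dA.pow 2)).add (((dA.pow 2).const_mul a).div did hz.ne')).add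
      (did.mul (dB.pow 2))).sub ((dA.const_mul (2 * a)).mul dB)
    refine (h.congr_of_eventuallyEq (Filter.Eventually.of_forall fun w => by simp [hE])).congr_deriv ?_
    simp only [id, ha, Pi.pow_apply]
    push_cast
    field_simp
    ring
  obtain ⟨Z, hZ0, hZ⟩ : ∃ Z : ℝ, 0 < Z ∧ ∀ z, Z ≤ z → z * A z * A z ≤ 2 / Real.pi + 1 := by
    have h1 : ∀ᶠ z in atTop, z * A z * A z - cc ν z * cc ν z < 1 :=
      huu'.eventually (gt_mem_nhds one_pos)
    obtain ⟨Z, hZ⟩ := Filter.eventually_atTop.1 h1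
    refine ⟨max Z 1, by positivity, fun z hz => ?_⟩
    have := hZ z ((le_max_left _ _).trans hz)
    have h2 := (abs_le.1 (pb _ _ (cc_bd ν z) (cc_bd ν z))).2
    linarith
  have hdec := decay (f := E) (f' := fun z => 2 * a * (a - 1) * A z ^ 2 / z ^ 2)
    (D := |2 * a * (a - 1)| * (2 / Real.pi + 1)) hZ0 (fun z hz => hEd z (by linarith))
    (fun z hz => by
      have hz0 : 0 < z := by linarith
      have h1 := hZ z hz
      have h2 : 2 * a * (a - 1) * A z ^ 2 / z ^ 2 = 2 * a * (a - 1) * (z * A z * A z) / z ^ 3 := by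
        field_simp
      have h3 : 0 ≤ z * A z * A z := by rw [mul_assoc]; exact mul_nonneg hz0.le (mul_self_nonneg _)
      rw [h2, abs_div, abs_mul, abs_of_nonneg h3, abs_of_pos (by positivity : 0 < z ^ 3)]
      gcongr) hEl
  have fin := (hdec.sub (tuu.const_mul (a / 2))).add (huv'.const_mul (1 / 2))
  simp only [mul_zero, add_zero, sub_zero] at fin
  refine fin.congr' ?_
  filter_upwards [eventually_gt_atTop 0] with z hz
  have hsin : Real.sin (2 * z - 2 * (Real.pi * ν / 2 + Real.pi / 4)) / (2 * Real.pi) =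
      1 / 2 * (cc ν z * ss ν z) := by
    rw [cc, ss, ← mul_sub, Real.sin_two_mul]
    have : Real.pi * Real.sqrt (2 / Real.pi) ^ 2 = 2 := by rw [c2]; field_simp
    rw [div_eq_iff (by positivity)]
    linear_combination (-(Real.sin (z - (Real.pi * ν / 2 + Real.pi / 4)) *
      Real.cos (z - (Real.pi * ν / 2 + Real.pi / 4)))) * this
  rw [hsin, hE, ha]
  field_simp
  ring

lemma bG_cont (ν : ℝ) (hν : -1 < ν) : Continuous (bG ν) :=
  continuous_iff_continuousAt.2 (fun w => (bG_hasDerivAt ν hν w).continuousAt)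

/-- continuous factor of `J_μ(xs) J_lam(ys)` -/
def hh (μ lam x y s : ℝ) : ℝ :=
  (x / 2) ^ μ * (y / 2) ^ lam * bG μ ((x * s) ^ 2 / 4) * bG lam ((y * s) ^ 2 / 4)

lemma hh_cont (μ lam x y : ℝ) (hμ : -1 < μ) (hl : -1 < lam) : Continuous (hh μ lam x y) := by
  have h1 := bG_cont μ hμ
  have h2 := bG_cont lam hl
  unfold hh
  fun_prop

lemma prod_eq (n : ℕ) (μ lam x y s : ℝ) (hx : 0 < x) (hy : 0 < y) (hs : 0 < s) :
    s ^ n * besselJ μ (x * s) * besselJ lam (y * s) = s ^ (n + μ + lam) * hh μ lam x y s := by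
  rw [besselJ_eq _ (by positivity), besselJ_eq _ (by positivity), hh, Real.rpow_add hs,
    Real.rpow_add hs, Real.rpow_natCast, mul_div_right_comm, mul_div_right_comm,
    Real.mul_rpow (by positivity) hs.le, Real.mul_rpow (by positivity) hs.le]
  ring

lemma prod_cont (n : ℕ) (hn : n ≠ 0) (μ lam x y : ℝ) (hμ : -1 < μ) (hl : -1 < lam) (hx : 0 < x)
    (hy : 0 < y) (h : 0 < n + μ + lam) :
    ContinuousOn (fun s => s ^ n * besselJ μ (x * s) * besselJ lam (y * s)) (Set.Ici 0) := by
  have : ContinuousOn (fun s : ℝ => s ^ (n + μ + lam) * hh μ lam x y s) (Set.Ici 0) :=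
    ((Real.continuous_rpow_const h.le).mul (hh_cont μ lam x y hμ hl)).continuousOn
  refine this.congr (fun s hs => ?_)
  rcases (Set.mem_Ici.1 hs).eq_or_lt with rfl | hs
  · simp only []
    rw [Real.zero_rpow h.ne', zero_pow hn]; ring
  · exact prod_eq n μ lam x y s hx hy hs

lemma prod_int (ν x y : ℝ) (hν : -1 < ν) (hx : 0 < x) (hy : 0 < y) {S : ℝ} (hS : 0 ≤ S) :
    IntervalIntegrable (fun s => s * besselJ ν (x * s) * besselJ ν (y * s)) MeasureTheory.volume 0 S := by
  have h1 : IntervalIntegrable (fun s : ℝ => s ^ (((1:ℕ):ℝ) + ν + ν) * hh ν ν x y s)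
      MeasureTheory.volume 0 S :=
    (intervalIntegral.intervalIntegrable_rpow' (by push_cast; linarith)).mul_continuousOn
      (hh_cont ν ν x y hν hν).continuousOn
  refine h1.congr (fun s hs => ?_)
  rw [Set.uIoc_of_le hS] at hs
  have := prod_eq 1 ν ν x y s hx hy hs.1
  rw [pow_one] at this
  exact this.symm

lemma ftc_ne (ν x y : ℝ) (hν : -1 < ν) (hx : 0 < x) (hy : 0 < y) {S : ℝ} (hS : 0 ≤ S) :
    (x ^ 2 - y ^ 2) * ∫ s in (0:ℝ)..S, s * besselJ ν (x * s) * besselJ ν (y * s) =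
      S * (x * besselJ (ν + 1) (x * S) * besselJ ν (y * S) -
        y * besselJ ν (x * S) * besselJ (ν + 1) (y * S)) := by
  rw [← intervalIntegral.integral_const_mul]
  have key := intervalIntegral.integral_eq_sub_of_hasDerivAt_of_le hS
    (f := fun s => x * (s ^ 1 * besselJ (ν + 1) (x * s) * besselJ ν (y * s)) -
        y * (s ^ 1 * besselJ ν (x * s) * besselJ (ν + 1) (y * s)))
    (f' := fun s => (x ^ 2 - y ^ 2) * (s * besselJ ν (x * s) * besselJ ν (y * s)))
    (by
      have h1 := prod_cont 1 one_ne_zero (ν + 1) ν x y (by linarith) hν hx hy (by push_cast; linarith)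
      have h2 := prod_cont 1 one_ne_zero ν (ν + 1) x y hν (by linarith) hx hy (by push_cast; linarith)
      exact ((h1.const_mul x).sub (h2.const_mul y)).mono (fun s hs => hs.1))
    (fun s hs => by
      have hs0 : 0 < s := hs.1
      have lx : HasDerivAt (fun s : ℝ => x * s) x s := by simpa using (hasDerivAt_id s).const_mul x
      have ly : HasDerivAt (fun s : ℝ => y * s) y s := by simpa using (hasDerivAt_id s).const_mul y
      have A := (besselJ_deriv ν hν (mul_pos hx hs0)).comp s lx
      have B := (besselJ_deriv_succ ν hν (mul_pos hx hs0)).comp s lx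
      have C := (besselJ_deriv ν hν (mul_pos hy hs0)).comp s ly
      have D := (besselJ_deriv_succ ν hν (mul_pos hy hs0)).comp s ly
      have p := hasDerivAt_pow 1 s
      have h := (((p.mul B).mul C).const_mul x).sub (((p.mul A).mul D).const_mul y)
      refine h.congr_deriv ?_
      simp only [Function.comp, Pi.mul_apply]
      push_cast
      field_simp
      ring)
    ((prod_int ν x y hν hx hy hS).const_mul _)
  rw [key]
  simp
  ring

lemma ftc_eq (ν x : ℝ) (hν : -1 < ν) (hx : 0 < x) {S : ℝ} (hS : 0 ≤ S) :
    ∫ s in (0:ℝ)..S, s * besselJ ν (x * s) * besselJ ν (x * s) =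
      S ^ 2 / 2 * (besselJ ν (x * S) ^ 2 + besselJ (ν + 1) (x * S) ^ 2)
        - ν * S / x * besselJ ν (x * S) * besselJ (ν + 1) (x * S) := by
  have key := intervalIntegral.integral_eq_sub_of_hasDerivAt_of_le hS
    (f := fun s => 1 / 2 * (s ^ 2 * besselJ ν (x * s) * besselJ ν (x * s)) +
        1 / 2 * (s ^ 2 * besselJ (ν + 1) (x * s) * besselJ (ν + 1) (x * s)) -
        ν / x * (s ^ 1 * besselJ ν (x * s) * besselJ (ν + 1) (x * s)))
    (f' := fun s => s * besselJ ν (x * s) * besselJ ν (x * s))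
    (by
      have h1 := prod_cont 2 two_ne_zero ν ν x x hν hν hx hx (by push_cast; linarith)
      have h2 := prod_cont 2 two_ne_zero (ν + 1) (ν + 1) x x (by linarith) (by linarith) hx hx
        (by push_cast; linarith)
      have h3 := prod_cont 1 one_ne_zero ν (ν + 1) x x hν (by linarith) hx hx (by push_cast; linarith)
      exact (((h1.const_mul (1 / 2)).add (h2.const_mul (1 / 2))).sub (h3.const_mul (ν / x))).mono
        (fun s hs => hs.1))
    (fun s hs => by
      have hs0 : 0 < s := hs.1
      have lx : HasDerivAt (fun s : ℝ => x * s) x s := by simpa using (hasDerivAt_id s).const_mul x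
      have A := (besselJ_deriv ν hν (mul_pos hx hs0)).comp s lx
      have B := (besselJ_deriv_succ ν hν (mul_pos hx hs0)).comp s lx
      have p := hasDerivAt_pow 1 s
      have q := hasDerivAt_pow 2 s
      have h := ((((q.mul A).mul A).const_mul (1 / 2)).add (((q.mul B).mul B).const_mul (1 / 2))).sub
        (((p.mul A).mul B).const_mul (ν / x))
      refine h.congr_deriv ?_
      simp only [Function.comp, Pi.mul_apply]
      push_cast
      field_simp
      ring)
    (prod_int ν x x hν hx hx hS)
  rw [key]
  simp
  ring

lemma cos_ne (α x y S : ℝ) (hxy : x - y ≠ 0) (hxy' : x + y ≠ 0) :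
    ∫ s in (0:ℝ)..S, 2 * Real.cos (x * s - α) * Real.cos (y * s - α) / Real.pi =
      (Real.sin ((x - y) * S) / (x - y) + (Real.sin ((x + y) * S - 2 * α) + Real.sin (2 * α)) / (x + y))
        / Real.pi := by
  rw [intervalIntegral.integral_eq_sub_of_hasDerivAt
    (f := fun s => (Real.sin ((x - y) * s) / (x - y) + Real.sin ((x + y) * s - 2 * α) / (x + y))
        / Real.pi)]
  · simp
    ring
  · intro s _
    have l1 : HasDerivAt (fun s : ℝ => (x - y) * s) (x - y) s := by
      simpa using (hasDerivAt_id s).const_mul (x - y)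
    have l2 : HasDerivAt (fun s : ℝ => (x + y) * s - 2 * α) (x + y) s := by
      simpa using ((hasDerivAt_id s).const_mul (x + y)).sub_const (2 * α)
    have h := ((l1.sin.div_const (x - y)).add (l2.sin.div_const (x + y))).div_const Real.pi
    refine h.congr_deriv ?_
    rw [mul_div_cancel_right₀ _ hxy, mul_div_cancel_right₀ _ hxy',
      show (x - y) * s = (x * s - α) - (y * s - α) by ring,
      show (x + y) * s - 2 * α = (x * s - α) + (y * s - α) by ring, Real.cos_sub, Real.cos_add]
    ring
  · exact (by fun_prop : Continuous _).intervalIntegrable _ _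

lemma cos_eq (α x S : ℝ) (hx : x ≠ 0) :
    ∫ s in (0:ℝ)..S, 2 * Real.cos (x * s - α) * Real.cos (x * s - α) / Real.pi =
      (S + (Real.sin (2 * (x * S) - 2 * α) + Real.sin (2 * α)) / (2 * x)) / Real.pi := by
  rw [intervalIntegral.integral_eq_sub_of_hasDerivAt
    (f := fun s => (s + Real.sin (2 * (x * s) - 2 * α) / (2 * x)) / Real.pi)]
  · simp
    ring
  · intro s _
    have l2 : HasDerivAt (fun s : ℝ => 2 * (x * s) - 2 * α) (2 * x) s := by
      simpa using (((hasDerivAt_id s).const_mul x).const_mul 2).sub_const (2 * α)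
    have h := ((hasDerivAt_id s).add (l2.sin.div_const (2 * x))).div_const Real.pi
    refine h.congr_deriv ?_
    rw [mul_div_cancel_right₀ _ (by positivity),
      show 2 * (x * s) - 2 * α = 2 * (x * s - α) by ring, Real.cos_two_mul]
    ring
  · exact (by fun_prop : Continuous _).intervalIntegrable _ _

lemma main_int (ν : ℝ) (hν : -1 < ν) (x y : ℝ) (hx : 0 < x) (hy : 0 < y) (α : ℝ) {S : ℝ} (hS : 0 ≤ S) :
    IntervalIntegrable (fun s => s * Real.sqrt (x * y) * besselJ ν (x * s) * besselJ ν (y * s) -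
          2 * Real.cos (x * s - α) * Real.cos (y * s - α) / Real.pi) MeasureTheory.volume 0 S := by
  have h1 := (prod_int ν x y hν hx hy hS).const_mul (Real.sqrt (x * y))
  have h2 : IntervalIntegrable (fun s : ℝ => 2 * Real.cos (x * s - α) * Real.cos (y * s - α) / Real.pi)
    MeasureTheory.volume 0 S := (by fun_prop : Continuous _).intervalIntegrable _ _
  refine (h1.sub h2).congr (fun s _ => ?_)
  ring

lemma main_split (ν : ℝ) (hν : -1 < ν) (x y : ℝ) (hx : 0 < x) (hy : 0 < y) (α : ℝ) {S : ℝ} (hS : 0 ≤ S) :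
    ∫ s in (0:ℝ)..S, (s * Real.sqrt (x * y) * besselJ ν (x * s) * besselJ ν (y * s) -
          2 * Real.cos (x * s - α) * Real.cos (y * s - α) / Real.pi) =
      Real.sqrt (x * y) * (∫ s in (0:ℝ)..S, s * besselJ ν (x * s) * besselJ ν (y * s)) -
        ∫ s in (0:ℝ)..S, 2 * Real.cos (x * s - α) * Real.cos (y * s - α) / Real.pi := by
  have h1 := (prod_int ν x y hν hx hy hS).const_mul (Real.sqrt (x * y))
  have h2 : IntervalIntegrable (fun s : ℝ => 2 * Real.cos (x * s - α) * Real.cos (y * s - α) / Real.pi)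
    MeasureTheory.volume 0 S := (by fun_prop : Continuous _).intervalIntegrable _ _
  rw [← intervalIntegral.integral_const_mul, ← intervalIntegral.integral_sub h1 h2]
  refine intervalIntegral.integral_congr (fun s _ => ?_)
  ring

lemma bessel_lim_ne (ν : ℝ) (hν : -1 < ν) (x y : ℝ) (hx : 0 < x) (hy : 0 < y) (hxy : x ≠ y) :
    Tendsto
      (fun S : ℝ => ∫ s in (0 : ℝ)..S,
        (s * Real.sqrt (x * y) * besselJ ν (x * s) * besselJ ν (y * s) -
          2 * Real.cos (x * s - (Real.pi * ν / 2 + Real.pi / 4)) *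
            Real.cos (y * s - (Real.pi * ν / 2 + Real.pi / 4)) / Real.pi))
      atTop
      (nhds (-Real.sin (2 * (Real.pi * ν / 2 + Real.pi / 4)) / (Real.pi * (x + y)))) := by
  have hd : x - y ≠ 0 := sub_ne_zero.2 hxy
  have hsum : x + y ≠ 0 := by positivity
  have hp := Real.pi_pos
  have c2 : Real.sqrt (2 / Real.pi) ^ 2 = 2 / Real.pi := Real.sq_sqrt (by positivity)
  have sx : Tendsto (fun S : ℝ => x * S) atTop atTop := tendsto_id.const_mul_atTop hx
  have sy : Tendsto (fun S : ℝ => y * S) atTop atTop := tendsto_id.const_mul_atTop hy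
  have p1 := prod_asym ((asym_v ν hν).comp sx) ((asym_u ν hν).comp sy) _
    (fun S => ss_bd ν (x * S)) (fun S => cc_bd ν (y * S))
  have p2 := prod_asym ((asym_u ν hν).comp sx) ((asym_v ν hν).comp sy) _
    (fun S => cc_bd ν (x * S)) (fun S => ss_bd ν (y * S))
  have p := (((p1.const_mul x).sub (p2.const_mul y)).div_const (x ^ 2 - y ^ 2)).add_const
    (-Real.sin (2 * (Real.pi * ν / 2 + Real.pi / 4)) / (Real.pi * (x + y)))
  simp only [mul_zero, sub_zero, zero_div, zero_add] at p
  refine p.congr' ?_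
  filter_upwards [eventually_ge_atTop 0] with S hS
  have hD : x ^ 2 - y ^ 2 ≠ 0 := by
    rw [show x ^ 2 - y ^ 2 = (x - y) * (x + y) by ring]; exact mul_ne_zero hd hsum
  have hI := ftc_ne ν x y hν hx hy hS
  rw [main_split ν hν x y hx hy _ hS, cos_ne _ x y S hd hsum, eq_div_of_mul_eq hD ((mul_comm _ _).trans hI)]
  have hsq : Real.sqrt (x * S) * Real.sqrt (y * S) = Real.sqrt (x * y) * S := by
    rw [← Real.sqrt_mul (by positivity), show x * S * (y * S) = (x * y) * S ^ 2 by ring,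
      Real.sqrt_mul (by positivity), Real.sqrt_sq hS]
  set α := Real.pi * ν / 2 + Real.pi / 4
  have t1 : ss ν (x * S) * cc ν (y * S) =
      2 / Real.pi * (Real.sin (x * S - α) * Real.cos (y * S - α)) := by
    rw [← c2, ss, cc]; ring
  have t2 : cc ν (x * S) * ss ν (y * S) =
      2 / Real.pi * (Real.cos (x * S - α) * Real.sin (y * S - α)) := by
    rw [← c2, ss, cc]; ring
  rw [t1, t2, show (x - y) * S = (x * S - α) - (y * S - α) by ring,
      show (x + y) * S - 2 * α = (x * S - α) + (y * S - α) by ring, Real.sin_sub (x * S - α),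
      Real.sin_add (x * S - α)]
  have e1 : ∀ p q : ℝ, Real.sqrt (x * S) * p * (Real.sqrt (y * S) * q) = Real.sqrt (x * y) * S * p * q := by
    intro p q; rw [← hsq]; ring
  rw [e1, e1]
  rw [show x ^ 2 - y ^ 2 = (x - y) * (x + y) by ring]
  field_simp
  ring

lemma bessel_lim_eq (ν : ℝ) (hν : -1 < ν) (x : ℝ) (hx : 0 < x) :
    Tendsto
      (fun S : ℝ => ∫ s in (0 : ℝ)..S,
        (s * Real.sqrt (x * x) * besselJ ν (x * s) * besselJ ν (x * s) -
          2 * Real.cos (x * s - (Real.pi * ν / 2 + Real.pi / 4)) *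
            Real.cos (x * s - (Real.pi * ν / 2 + Real.pi / 4)) / Real.pi))
      atTop
      (nhds (-Real.sin (2 * (Real.pi * ν / 2 + Real.pi / 4)) / (Real.pi * (x + x)))) := by
  have hp := Real.pi_pos
  have sx : Tendsto (fun S : ℝ => x * S) atTop atTop := tendsto_id.const_mul_atTop hx
  have p := (((diag_asym ν hν).comp sx).div_const x).add_const
    (-Real.sin (2 * (Real.pi * ν / 2 + Real.pi / 4)) / (Real.pi * (x + x)))
  simp only [zero_div, zero_add] at p
  refine p.congr' ?_
  filter_upwards [eventually_ge_atTop 0] with S hS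
  rw [main_split ν hν x x hx hx _ hS, cos_eq _ x S hx.ne', ftc_eq ν x hν hx hS, Real.sqrt_mul_self hx.le]
  simp only [Function.comp]
  field_simp
  ring

/-- For `ν > -1`, `x, y ∈ [1,∞)` and `t ∈ [0,∞)`, the improper integral
`K_t(x,y) = ∫_t^∞ (s √(xy) J_ν(xs) J_ν(ys) - (2/π) cos(xs - α) cos(ys - α)) ds` converges,
and `K_0(x,y) = -sin(2α)/(π(x+y))`, where `α = πν/2 + π/4`. -/
theorem besselJ_tail_integral_converges
    (ν : ℝ) (hν : -1 < ν) (x y : ℝ) (hx : 1 ≤ x) (hy : 1 ≤ y) :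
    (∀ t : ℝ, 0 ≤ t → ∃ L : ℝ,
      Tendsto
        (fun S : ℝ => ∫ s in t..S,
          (s * Real.sqrt (x * y) * besselJ ν (x * s) * besselJ ν (y * s) -
            2 * Real.cos (x * s - (Real.pi * ν / 2 + Real.pi / 4)) *
              Real.cos (y * s - (Real.pi * ν / 2 + Real.pi / 4)) / Real.pi))
        atTop (nhds L)) ∧
    Tendsto
      (fun S : ℝ => ∫ s in (0 : ℝ)..S,
        (s * Real.sqrt (x * y) * besselJ ν (x * s) * besselJ ν (y * s) -
          2 * Real.cos (x * s - (Real.pi * ν / 2 + Real.pi / 4)) *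
            Real.cos (y * s - (Real.pi * ν / 2 + Real.pi / 4)) / Real.pi))
      atTop
      (nhds (-Real.sin (2 * (Real.pi * ν / 2 + Real.pi / 4)) / (Real.pi * (x + y)))) := by
  have hx0 : 0 < x := by linarith
  have hy0 : 0 < y := by linarith
  have hlim : Tendsto
      (fun S : ℝ => ∫ s in (0 : ℝ)..S,
        (s * Real.sqrt (x * y) * besselJ ν (x * s) * besselJ ν (y * s) -
          2 * Real.cos (x * s - (Real.pi * ν / 2 + Real.pi / 4)) *
            Real.cos (y * s - (Real.pi * ν / 2 + Real.pi / 4)) / Real.pi))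
      atTop
      (nhds (-Real.sin (2 * (Real.pi * ν / 2 + Real.pi / 4)) / (Real.pi * (x + y)))) := by
    by_cases hxy : x = y
    · subst hxy
      exact bessel_lim_eq ν hν x hx0
    · exact bessel_lim_ne ν hν x y hx0 hy0 hxy
  refine ⟨fun t ht => ?_, hlim⟩
  refine ⟨_, (hlim.sub_const (∫ s in (0 : ℝ)..t,
        (s * Real.sqrt (x * y) * besselJ ν (x * s) * besselJ ν (y * s) -
          2 * Real.cos (x * s - (Real.pi * ν / 2 + Real.pi / 4)) *
            Real.cos (y * s - (Real.pi * ν / 2 + Real.pi / 4)) / Real.pi))).congr' ?_⟩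
  filter_upwards [eventually_ge_atTop 0] with S hS
  exact intervalIntegral.integral_interval_sub_left (main_int ν hν x y hx0 hy0 _ hS)
    (main_int ν hν x y hx0 hy0 _ ht)

end
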